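/- Let p ≥ 2 and Φ(x) = ‖x‖^p/p on ℝⁿ (Euclidean norm), with μ_Φ(dx) = e^{-Φ(x)} dx / Z_Φ. Then there exists a constant c > 0 such that for all smooth enough g, Ent_{μ_Φ}(e^g) ≤ c ∫ ‖∇g‖^q e^g dμ_Φ, where 1/p + 1/q = 1. -/

import Mathlib

open MeasureTheory Real

/-- The entropy of `f` with respect to `μ`. -/
noncomputable def Ent {n : ℕ} (μ : Measure (EuclideanSpace ℝ (Fin n)))
    (f : EuclideanSpace ℝ (Fin n) → ℝ) : ℝ :=
  ∫ x, f x * Real.log (f x / ∫ y, f y ∂μ) ∂μ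

open scoped Pointwise in
/-- The Brunn–Minkowski inequality on the real line. -/
theorem volume_add_volume_le_of_add_subset {A B C : Set ℝ} (hA : MeasurableSet A)
    (hB : MeasurableSet B) (hA₀ : A.Nonempty) (hB₀ : B.Nonempty) (h : A + B ⊆ C) :
    volume A + volume B ≤ volume C := by
  obtain ⟨a₀, ha₀⟩ := hA₀
  obtain ⟨b₀, hb₀⟩ := hB₀
  have compact_case : ∀ K L : Set ℝ, K ⊆ A → L ⊆ B → IsCompact K → IsCompact L →
      K.Nonempty → L.Nonempty → volume K + volume L ≤ volume C := by
    intro K L hKA hLB hK hL hK₀ hL₀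
    obtain ⟨a, haK, ha⟩ := hK.exists_isGreatest hK₀
    obtain ⟨b, hbL, hb⟩ := hL.exists_isLeast hL₀
    have hsub : ((· + b) '' K) ∪ ((a + ·) '' (L \ {b})) ⊆ C := by
      refine Set.Subset.trans ?_ h
      rintro _ (⟨x, hx, rfl⟩ | ⟨y, hy, rfl⟩)
      · exact Set.add_mem_add (hKA hx) (hLB hbL)
      · exact Set.add_mem_add (hKA haK) (hLB hy.1)
    have hdisj : Disjoint ((· + b) '' K) ((a + ·) '' (L \ {b})) := by
      rw [Set.disjoint_left]
      rintro _ ⟨x, hx, rfl⟩ ⟨y, ⟨hy, hyb⟩, hxy⟩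
      have h1 : x ≤ a := ha hx
      have h2 : b ≤ y := hb hy
      simp only at hxy
      exact hyb (by simp only [Set.mem_singleton_iff]; linarith)
    calc volume K + volume L
        = volume ((· + b) '' K) + volume ((a + ·) '' (L \ {b})) := by
          rw [Set.image_add_right, measure_preimage_add_right, Set.image_add_left,
            measure_preimage_add, measure_sdiff_null (by simp)]
      _ = volume (((· + b) '' K) ∪ ((a + ·) '' (L \ {b}))) := by
          refine (measure_union hdisj ?_).symm
          rw [Set.image_add_left]
          exact (measurable_const_add _) (hL.measurableSet.diff (measurableSet_singleton b))
      _ ≤ volume C := measure_mono hsub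
  rw [hA.measure_eq_iSup_isCompact, hB.measure_eq_iSup_isCompact]
  simp only [iSup_and']
  refine ENNReal.biSup_add_biSup_le' ⟨∅, by simp⟩ ⟨∅, by simp⟩ fun K hK L hL => ?_
  refine (add_le_add (measure_mono (Set.subset_insert a₀ K))
    (measure_mono (Set.subset_insert b₀ L))).trans ?_
  exact compact_case _ _ (Set.insert_subset ha₀ hK.1) (Set.insert_subset hb₀ hL.1)
    (hK.2.insert a₀) (hL.2.insert b₀) (Set.insert_nonempty _ _) (Set.insert_nonempty _ _)

open scoped ENNReal in
theorem lintegral_eq_lintegral_Ioo_measure_lt {α : Type*} [MeasurableSpace α] (μ : Measure α)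
    {f : α → ℝ≥0∞} (hf : Measurable f) (hf1 : ∀ x, f x ≤ 1) :
    ∫⁻ x, f x ∂μ = ∫⁻ l in Set.Ioo (0 : ℝ) 1, μ {x | ENNReal.ofReal l < f x} := by
  have hfin : ∀ x, f x ≠ ∞ := fun x => ne_top_of_le_ne_top ENNReal.one_ne_top (hf1 x)
  have h1 : ∫⁻ x, f x ∂μ = ∫⁻ x, ENNReal.ofReal (f x).toReal ∂μ := by
    simp [ENNReal.ofReal_toReal, hfin]
  rw [h1, lintegral_eq_lintegral_meas_lt μ (Filter.Eventually.of_forall fun x => by simp)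
    hf.ennreal_toReal.aemeasurable]
  have h2 : ∀ l ∈ Set.Ioi (0 : ℝ), μ {a | l < (f a).toReal}
      = (Set.Ioo (0 : ℝ) 1).indicator (fun l => μ {x | ENNReal.ofReal l < f x}) l := by
    intro l hl
    by_cases hl1 : l < 1
    · rw [Set.indicator_of_mem (show l ∈ Set.Ioo (0 : ℝ) 1 from ⟨hl, hl1⟩)]
      congr 1
      ext x
      exact (ENNReal.ofReal_lt_iff_lt_toReal (le_of_lt hl) (hfin x)).symm
    · rw [Set.indicator_of_notMem (fun h => hl1 h.2)]
      convert measure_empty (μ := μ)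
      ext x
      have := ENNReal.toReal_mono ENNReal.one_ne_top (hf1 x)
      simp only [ENNReal.toReal_one] at this
      simp only [Set.mem_ofPred_eq, Set.mem_empty_iff_false, iff_false, not_lt]
      linarith
  rw [setLIntegral_congr_fun measurableSet_Ioi h2, setLIntegral_indicator measurableSet_Ioo,
    Set.inter_eq_left.2 Set.Ioo_subset_Ioi_self]

open scoped ENNReal in
theorem ENNReal.rpow_mul_rpow_le_weighted_add {t s : ℝ} (ht : 0 < t) (hs : 0 < s)
    (hts : t + s = 1) (a b : ℝ≥0∞) :
    a ^ t * b ^ s ≤ ENNReal.ofReal t * a + ENNReal.ofReal s * b := by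
  have hpq : (t⁻¹).HolderConjugate s⁻¹ := by
    rw [Real.holderConjugate_iff]
    refine ⟨?_, by simpa using hts⟩
    rw [one_lt_inv₀ ht]; linarith
  have := ENNReal.young_inequality (a ^ t) (b ^ s) hpq
  rw [← ENNReal.rpow_mul, ← ENNReal.rpow_mul, mul_inv_cancel₀ ht.ne', mul_inv_cancel₀ hs.ne',
    ENNReal.rpow_one, ENNReal.rpow_one, ENNReal.ofReal_inv_of_pos ht,
    ENNReal.ofReal_inv_of_pos hs, div_eq_mul_inv, div_eq_mul_inv, inv_inv, inv_inv] at this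
  rwa [mul_comm _ a, mul_comm _ b]

open scoped ENNReal in
theorem ENNReal.lt_rpow_mul_rpow {t s : ℝ} (ht : 0 < t) (hs : 0 < s) (hts : t + s = 1)
    {a b c : ℝ≥0∞} (ha : c < a) (hb : c < b) : c < a ^ t * b ^ s := by
  calc c = c ^ t * c ^ s := by
        rw [← ENNReal.rpow_add_of_nonneg _ _ ht.le hs.le, hts, ENNReal.rpow_one]
    _ < a ^ t * b ^ s :=
        ENNReal.mul_lt_mul (ENNReal.rpow_lt_rpow ha ht) (ENNReal.rpow_lt_rpow hb hs)

open scoped ENNReal Pointwise in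
theorem lintegral_weighted_add_le_of_iSup_eq_one {t s : ℝ} (ht : 0 < t) (hs : 0 < s)
    (hts : t + s = 1) {f g h : ℝ → ℝ≥0∞} (hf : Measurable f) (hg : Measurable g)
    (hh : Measurable h) (hf1 : ⨆ x, f x = 1) (hg1 : ⨆ x, g x = 1)
    (H : ∀ x y, f x ^ t * g y ^ s ≤ h (t * x + s * y)) :
    ENNReal.ofReal t * (∫⁻ x, f x) + ENNReal.ofReal s * (∫⁻ x, g x) ≤ ∫⁻ x, h x := by
  have hf1' : ∀ x, f x ≤ 1 := fun x => hf1 ▸ le_iSup f x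
  have hg1' : ∀ x, g x ≤ 1 := fun x => hg1 ▸ le_iSup g x
  have hmin : Measurable fun x => min (h x) 1 := hh.min measurable_const
  refine le_trans ?_ (lintegral_mono (fun x => min_le_left (h x) 1))
  rw [lintegral_eq_lintegral_Ioo_measure_lt _ hf hf1', lintegral_eq_lintegral_Ioo_measure_lt _ hg hg1',
    lintegral_eq_lintegral_Ioo_measure_lt _ hmin (fun x => min_le_right _ _),
    ← lintegral_const_mul' _ _ ENNReal.ofReal_ne_top,
    ← lintegral_const_mul' _ _ ENNReal.ofReal_ne_top]
  refine (le_lintegral_add _ _).trans (setLIntegral_mono' measurableSet_Ioo ?_)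
  intro l hl
  have hl1 : ENNReal.ofReal l < 1 := by
    rw [ENNReal.ofReal_lt_one]; exact hl.2
  have hA : MeasurableSet {x | ENNReal.ofReal l < f x} := measurableSet_lt measurable_const hf
  have hB : MeasurableSet {x | ENNReal.ofReal l < g x} := measurableSet_lt measurable_const hg
  obtain ⟨a, ha⟩ := lt_iSup_iff.1 (hf1.symm ▸ hl1 : ENNReal.ofReal l < ⨆ x, f x)
  obtain ⟨b, hb⟩ := lt_iSup_iff.1 (hg1.symm ▸ hl1 : ENNReal.ofReal l < ⨆ x, g x)
  have key := volume_add_volume_le_of_add_subset (C := {x | ENNReal.ofReal l < min (h x) 1})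
    (hA.const_smul₀ t) (hB.const_smul₀ s) (Set.Nonempty.smul_set ⟨a, ha⟩)
    (Set.Nonempty.smul_set ⟨b, hb⟩) (by
      rintro _ ⟨_, ⟨x, hx, rfl⟩, _, ⟨y, hy, rfl⟩, rfl⟩
      exact lt_min ((ENNReal.lt_rpow_mul_rpow ht hs hts hx hy).trans_le (H x y)) hl1)
  simpa [Measure.addHaar_smul, abs_of_pos ht, abs_of_pos hs] using key

open scoped ENNReal in
theorem prekopa_leindler_of_iSup_ne_top {t s : ℝ} (ht : 0 < t) (hs : 0 < s)
    (hts : t + s = 1) {f g h : ℝ → ℝ≥0∞} (hf : Measurable f) (hg : Measurable g)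
    (hh : Measurable h) (hf1 : ⨆ x, f x ≠ ∞) (hg1 : ⨆ x, g x ≠ ∞)
    (H : ∀ x y, f x ^ t * g y ^ s ≤ h (t * x + s * y)) :
    (∫⁻ x, f x) ^ t * (∫⁻ x, g x) ^ s ≤ ∫⁻ x, h x := by
  set F := ⨆ x, f x with hF
  set G := ⨆ x, g x with hG
  by_cases hF0 : F = 0
  · have : ∀ x, f x = 0 := by simpa [hF] using hF0
    simp [this, ht]
  by_cases hG0 : G = 0
  · have : ∀ x, g x = 0 := by simpa [hG] using hG0
    simp [this, hs]
  have hFi : F⁻¹ ≠ ∞ := ENNReal.inv_ne_top.2 hF0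
  have hGi : G⁻¹ ≠ ∞ := ENNReal.inv_ne_top.2 hG0
  have key := lintegral_weighted_add_le_of_iSup_eq_one ht hs hts (hf.const_mul F⁻¹)
    (hg.const_mul G⁻¹) (hh.const_mul (F⁻¹ ^ t * G⁻¹ ^ s))
    (by rw [← ENNReal.mul_iSup, ENNReal.inv_mul_cancel hF0 hf1])
    (by rw [← ENNReal.mul_iSup, ENNReal.inv_mul_cancel hG0 hg1])
    (fun x y => by
      rw [ENNReal.mul_rpow_of_nonneg _ _ ht.le, ENNReal.mul_rpow_of_nonneg _ _ hs.le,
        mul_mul_mul_comm]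
      gcongr
      exact H x y)
  have key2 := (ENNReal.rpow_mul_rpow_le_weighted_add ht hs hts _ _).trans key
  rw [lintegral_const_mul _ hf, lintegral_const_mul _ hg, lintegral_const_mul _ hh,
    ENNReal.mul_rpow_of_nonneg _ _ ht.le, ENNReal.mul_rpow_of_nonneg _ _ hs.le,
    mul_mul_mul_comm] at key2
  refine (ENNReal.mul_le_mul_iff_right ?_ ?_).1 key2
  · exact mul_ne_zero (by simp [ENNReal.rpow_eq_zero_iff, hf1, hFi, ht])
      (by simp [ENNReal.rpow_eq_zero_iff, hg1, hGi, hs])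
  · exact ENNReal.mul_ne_top (ENNReal.rpow_ne_top_of_nonneg ht.le hFi)
      (ENNReal.rpow_ne_top_of_nonneg hs.le hGi)

open scoped ENNReal in
/-- The Prékopa–Leindler inequality with weights `t` and `s` on a measure space with a linear
structure. -/
def PrekopaLeindler (t s : ℝ) (E : Type*) [MeasureSpace E] [AddCommGroup E] [Module ℝ E] : Prop :=
  ∀ f g h : E → ℝ≥0∞, Measurable f → Measurable g → Measurable h →
    (∀ x y, f x ^ t * g y ^ s ≤ h (t • x + s • y)) →
    (∫⁻ x, f x) ^ t * (∫⁻ x, g x) ^ s ≤ ∫⁻ x, h x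

open scoped ENNReal in
theorem lintegral_eq_iSup_lintegral_min {α : Type*} [MeasurableSpace α] (μ : Measure α)
    {f : α → ℝ≥0∞} (hf : Measurable f) :
    ∫⁻ x, f x ∂μ = ⨆ N : ℕ, ∫⁻ x, min (f x) N ∂μ := by
  rw [← lintegral_iSup (fun N => hf.min measurable_const)
    (fun M N hMN x => min_le_min_left _ (by exact_mod_cast hMN))]
  congr 1
  ext x
  refine le_antisymm (le_of_forall_lt fun c hc => ?_) (iSup_le fun N => min_le_left _ _)
  obtain ⟨N, hN⟩ := ENNReal.exists_nat_gt (ne_top_of_lt hc)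
  exact (lt_min hc hN).trans_le (le_iSup (fun N : ℕ => min (f x) (N : ℝ≥0∞)) N)

open scoped ENNReal in
theorem PrekopaLeindler.real {t s : ℝ} (ht : 0 < t) (hs : 0 < s) (hts : t + s = 1) :
    PrekopaLeindler t s ℝ := by
  intro f g h hf hg hh H
  have hbdd : ∀ (u : ℝ → ℝ≥0∞) (N : ℕ), ⨆ x, min (u x) N ≠ ∞ := fun u N =>
    ne_top_of_le_ne_top (ENNReal.natCast_ne_top N) (iSup_le fun x => min_le_right _ _)
  have key : ∀ N : ℕ, (∫⁻ x, min (f x) N) ^ t * (∫⁻ x, min (g x) N) ^ s ≤ ∫⁻ x, h x :=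
    fun N => prekopa_leindler_of_iSup_ne_top ht hs hts (hf.min measurable_const)
      (hg.min measurable_const) hh (hbdd f N) (hbdd g N) fun x y =>
        le_trans (by gcongr <;> exact min_le_left _ _) (H x y)
  have hlim : ∀ {u : ℝ → ℝ≥0∞}, Measurable u → Filter.Tendsto (fun N : ℕ => ∫⁻ x, min (u x) N)
      Filter.atTop (nhds (∫⁻ x, u x)) := fun {u} hu => by
    rw [lintegral_eq_iSup_lintegral_min _ hu]
    exact tendsto_atTop_iSup fun M N hMN => lintegral_mono fun x =>
      min_le_min_left _ (by exact_mod_cast hMN)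
  by_cases hf0 : ∫⁻ x, f x = 0
  · simp [hf0, ht]
  by_cases hg0 : ∫⁻ x, g x = 0
  · simp [hg0, hs]
  refine le_of_tendsto' (ENNReal.Tendsto.mul ((hlim hf).ennrpow_const t) (Or.inl ?_)
    ((hlim hg).ennrpow_const s) (Or.inl ?_)) key
  · simp [ENNReal.rpow_eq_zero_iff, hf0, ht.le]
  · simp [ENNReal.rpow_eq_zero_iff, hg0, hs.le]

theorem PrekopaLeindler.prod {t s : ℝ} {E F : Type*} [MeasureSpace E] [AddCommGroup E]
    [Module ℝ E] [MeasureSpace F] [AddCommGroup F] [Module ℝ F]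
    [SFinite (volume : Measure F)]
    [MeasurableAdd F] (hE : PrekopaLeindler t s E) (hF : PrekopaLeindler t s F) :
    PrekopaLeindler t s (E × F) := by
  intro f g h hf hg hh H
  have hprod : (volume : Measure (E × F)) = (volume : Measure E).prod volume := rfl
  rw [hprod, lintegral_prod _ hf.aemeasurable, lintegral_prod _ hg.aemeasurable,
    lintegral_prod _ hh.aemeasurable]
  refine hE _ _ _ hf.lintegral_prod_right' hg.lintegral_prod_right' hh.lintegral_prod_right' ?_
  intro x y
  exact hF _ _ _ (hf.comp measurable_prodMk_left) (hg.comp measurable_prodMk_left)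
    (hh.comp measurable_prodMk_left) fun u v => H (x, u) (y, v)

theorem PrekopaLeindler.of_measurePreserving {t s : ℝ} {E F : Type*} [MeasureSpace E]
    [AddCommGroup E] [Module ℝ E] [MeasureSpace F] [AddCommGroup F] [Module ℝ F]
    (e : E ≃ᵐ F) (he : MeasurePreserving e) (hlin : ∀ x y, e (t • x + s • y) = t • e x + s • e y)
    (hE : PrekopaLeindler t s E) : PrekopaLeindler t s F := by
  intro f g h hf hg hh H
  rw [← he.lintegral_comp hf, ← he.lintegral_comp hg, ← he.lintegral_comp hh]
  exact hE _ _ _ (hf.comp he.measurable) (hg.comp he.measurable) (hh.comp he.measurable)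
    fun x y => by rw [hlin]; exact H _ _

theorem PrekopaLeindler.pi {t s : ℝ} (ht : 0 < t) (hs : 0 < s) (hts : t + s = 1) (n : ℕ) :
    PrekopaLeindler t s (Fin n → ℝ) := by
  induction n with
  | zero =>
    intro f g h hf hg hh H
    have h0 : ∀ x y z, f x ^ t * g y ^ s ≤ h z := fun x y z =>
      Subsingleton.elim (t • x + s • y) z ▸ H x y
    simpa [lintegral_unique, volume_pi, Measure.pi_of_empty, -Pi.default_def] using h0 _ _ _
  | succ n ih =>
    have e := (volume_preserving_piFinSuccAbove (fun _ : Fin (n + 1) => ℝ) 0)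
    refine ((PrekopaLeindler.real ht hs hts).prod ih).of_measurePreserving _ e.symm ?_
    intro x y
    ext i
    refine Fin.cases ?_ (fun j => ?_) i <;> simp [MeasurableEquiv.piFinSuccAbove]

theorem PrekopaLeindler.euclideanSpace {t s : ℝ} (ht : 0 < t) (hs : 0 < s) (hts : t + s = 1)
    (n : ℕ) : PrekopaLeindler t s (EuclideanSpace ℝ (Fin n)) :=
  (PrekopaLeindler.pi ht hs hts n).of_measurePreserving (MeasurableEquiv.toLp 2 _)
    (PiLp.volume_preserving_toLp (Fin n)) fun _ _ => rfl

/-- Uniform convexity of `‖·‖ ^ p` for `p ≥ 2`, in first-order form. -/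
theorem norm_rpow_add_inner_add_le {E : Type*} [NormedAddCommGroup E] [InnerProductSpace ℝ E]
    {p : ℝ} (hp : 2 ≤ p) (z v : E) :
    ‖z‖ ^ p + p * ‖z‖ ^ (p - 2) * inner ℝ z v + (1 / 8) ^ p * ‖v‖ ^ p ≤ ‖z + v‖ ^ p := by
  set a := ‖z‖ with ha
  set m := ‖v‖ with hm
  set b := inner ℝ z v with hb
  have ha0 : 0 ≤ a := norm_nonneg z
  have hm0 : 0 ≤ m := norm_nonneg v
  have hbam : b ≤ a * m := real_inner_le_norm z v
  have hrpow : ∀ u : ℝ, 0 ≤ u → u ^ p = u ^ (p - 2) * u ^ 2 := fun u hu => by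
    rw [← rpow_natCast u 2, ← rpow_add_of_nonneg hu (by linarith) (by norm_num)]
    norm_num
  rcases le_or_gt m (8 * a) with h | h
  · rcases ha0.eq_or_lt with h0 | h0
    · have hz : z = 0 := norm_eq_zero.1 (by rw [← ha, ← h0])
      have hv : v = 0 := norm_eq_zero.1 (by rw [← hm]; linarith)
      have hp0 : p ≠ 0 := by linarith
      simp [ha, hm, hb, hz, hv, hp0]
    have hsq : ‖z + v‖ ^ 2 = a ^ 2 * (1 + (2 * b + m ^ 2) / a ^ 2) := by
      rw [norm_add_sq_real]; field_simp; ring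
    have hge : -1 ≤ (2 * b + m ^ 2) / a ^ 2 := by
      have : 0 ≤ a ^ 2 * (1 + (2 * b + m ^ 2) / a ^ 2) := hsq ▸ sq_nonneg _
      have := nonneg_of_mul_nonneg_right this (by positivity)
      linarith
    have hbern := one_add_mul_self_le_rpow_one_add hge (p := p / 2) (by linarith)
    have hpow : ∀ u : ℝ, 0 ≤ u → u ^ p = (u ^ 2) ^ (p / 2) := fun u hu => by
      rw [← rpow_natCast u 2, ← rpow_mul hu]; congr 1; push_cast; ring
    have hmain : a ^ p * (1 + p / 2 * ((2 * b + m ^ 2) / a ^ 2)) ≤ ‖z + v‖ ^ p := by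
      rw [hpow ‖z + v‖ (norm_nonneg _), hsq, mul_rpow (by positivity) (by linarith), ← hpow a ha0]
      gcongr
    have hexp : a ^ p * (1 + p / 2 * ((2 * b + m ^ 2) / a ^ 2))
        = a ^ p + p * a ^ (p - 2) * b + p / 2 * a ^ (p - 2) * m ^ 2 := by
      rw [hrpow a ha0]; field_simp; ring
    have hgain : (1 / 8) ^ p * m ^ p ≤ p / 2 * a ^ (p - 2) * m ^ 2 := by
      have h1 : (m / 8) ^ (p - 2) ≤ a ^ (p - 2) :=
        rpow_le_rpow (by positivity) (by linarith) (by linarith)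
      have h2 : 0 ≤ (m / 8) ^ (p - 2) := by positivity
      rw [← mul_rpow (by norm_num) hm0, show 1 / 8 * m = m / 8 by ring,
        hrpow _ (by positivity)]
      calc (m / 8) ^ (p - 2) * (m / 8) ^ 2 ≤ a ^ (p - 2) * m ^ 2 := by gcongr; linarith
        _ ≤ p / 2 * (a ^ (p - 2) * m ^ 2) := le_mul_of_one_le_left (by positivity) (by linarith)
        _ = _ := by ring
    linarith
  · set k := m / 8 with hk
    have hmk : m = 8 * k := by rw [hk]; ring
    have hak : a ≤ k := by linarith
    have hk0 : 0 ≤ k := ha0.trans hak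
    have h1 : a ^ p ≤ k ^ p := rpow_le_rpow ha0 hak (by linarith)
    have h2 : p * a ^ (p - 2) * b ≤ 8 * p * k ^ p := by
      have : a ^ (p - 2) ≤ k ^ (p - 2) := rpow_le_rpow ha0 hak (by linarith)
      calc p * a ^ (p - 2) * b ≤ p * a ^ (p - 2) * (a * m) := by gcongr
        _ ≤ p * k ^ (p - 2) * (k * m) := by gcongr
        _ = 8 * p * k ^ p := by rw [hrpow k hk0, hmk]; ring
    have h3 : (1 / 8) ^ p * m ^ p = k ^ p := by
      rw [← mul_rpow (by norm_num) hm0]; congr 1; rw [hk]; ring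
    have h4 : (7 * k) ^ p ≤ ‖z + v‖ ^ p := by
      refine rpow_le_rpow (by positivity) ?_ (by linarith)
      have := norm_sub_norm_le v (-z)
      rw [norm_neg, sub_neg_eq_add, add_comm v z] at this
      linarith
    have h5 : 2 + 8 * p ≤ (7 : ℝ) ^ p := by
      have := one_add_mul_self_le_rpow_one_add (s := 48) (by norm_num) (p := p / 2) (by linarith)
      have h7 : (7 : ℝ) ^ p = (1 + 48) ^ (p / 2) := by
        rw [show (1 + 48 : ℝ) = 7 ^ (2 : ℝ) by norm_num, ← rpow_mul (by norm_num)]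
        congr 1; ring
      rw [h7]; linarith
    rw [mul_rpow (by norm_num) hk0] at h4
    have h6 := mul_le_mul_of_nonneg_right h5 (by positivity : 0 ≤ k ^ p)
    linarith

/-- Uniform convexity of `‖·‖ ^ p` for `p ≥ 2`. -/
theorem norm_rpow_convex_combination_add_le {E : Type*} [NormedAddCommGroup E]
    [InnerProductSpace ℝ E] {p t s : ℝ} (hp : 2 ≤ p) (ht : 0 ≤ t) (hs : 0 ≤ s) (hts : t + s = 1)
    (x y : E) :
    ‖t • x + s • y‖ ^ p + s * (t / 8) ^ p * ‖x - y‖ ^ p ≤ t * ‖x‖ ^ p + s * ‖y‖ ^ p := by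
  set z := t • x + s • y with hz
  have hs' : s = 1 - t := by linarith
  have hx : z + s • (x - y) = x := by rw [hz, hs']; module
  have hy : z + (-t) • (x - y) = y := by rw [hz, hs']; module
  have h1 := norm_rpow_add_inner_add_le hp z (s • (x - y))
  have h2 := norm_rpow_add_inner_add_le hp z ((-t) • (x - y))
  rw [hx, real_inner_smul_right] at h1
  rw [hy, real_inner_smul_right, norm_smul, norm_neg, norm_of_nonneg ht,
    mul_rpow ht (norm_nonneg _), ← mul_assoc ((1 / 8 : ℝ) ^ p), ← mul_rpow (by norm_num) ht,
    show 1 / 8 * t = t / 8 by ring] at h2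
  have h3 : 0 ≤ (1 / 8 : ℝ) ^ p * ‖s • (x - y)‖ ^ p := by positivity
  have h4 := mul_le_mul_of_nonneg_left h1 ht
  have h5 := mul_le_mul_of_nonneg_left h2 hs
  have h6 := mul_nonneg ht h3
  have h7 : ‖z‖ ^ p = t * ‖z‖ ^ p + s * ‖z‖ ^ p := by rw [← add_mul, hts, one_mul]
  linarith

/-- A supremal-convolution estimate for `g` against the cost given by the convexity defect of
`‖·‖ ^ p / p`, to first order in the small weight `s`. -/
theorem sub_le_sub_add_rpow {E : Type*} [NormedAddCommGroup E] [InnerProductSpace ℝ E]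
    {p q : ℝ} (hp : 2 ≤ p) (hpq : p.HolderConjugate q) {g : E → ℝ} (hg : Differentiable ℝ g)
    {L : ℝ} (hL : ∀ x, ‖fderiv ℝ g x‖ ≤ L) (huc : UniformContinuous (fderiv ℝ g))
    {η : ℝ} (hη : 0 < η) :
    ∃ s₀ > 0, ∀ t s : ℝ, 0 < t → 0 < s → s < s₀ → t + s = 1 → ∀ x y : E,
      g x - (t * (‖x‖ ^ p / p) + s * (‖y‖ ^ p / p)) ≤
        (g (t • x + s • y) + s * (16 ^ q / q * (‖fderiv ℝ g (t • x + s • y)‖ + η) ^ q)) -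
          ‖t • x + s • y‖ ^ p / p := by
  have hL0 : 0 ≤ L := (norm_nonneg _).trans (hL 0)
  have hp0 : 0 < p := by linarith
  obtain ⟨δ, hδ, hδg⟩ := Metric.uniformContinuous_iff.1 huc η hη
  set κ : ℝ := (1 / 16) ^ p / p with hκ
  have hκ0 : 0 < κ := by positivity
  set R : ℝ := (L / κ) ^ (1 / (p - 1)) with hR
  have hR0 : 0 ≤ R := by positivity
  refine ⟨min (1 / 2) (δ / (R + 1)), by positivity, fun t s ht hs hss hts x y => ?_⟩
  have hs2 : s < 1 / 2 := hss.trans_le (min_le_left _ _)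
  have hsδ : s * (R + 1) < δ := by
    rw [← lt_div_iff₀ (by positivity)]; exact hss.trans_le (min_le_right _ _)
  set z := t • x + s • y with hz
  set d := ‖x - y‖ with hd
  have hd0 : 0 ≤ d := norm_nonneg _
  have hxz : x - z = s • (x - y) := by
    rw [hz, show s = 1 - t by linarith]; module
  have hnxz : ‖x - z‖ = s * d := by rw [hxz, norm_smul, norm_of_nonneg hs.le]
  have hconv : ‖z‖ ^ p / p + s * (κ * d ^ p) ≤ t * (‖x‖ ^ p / p) + s * (‖y‖ ^ p / p) := by
    have h1 := norm_rpow_convex_combination_add_le hp ht.le hs.le hts x y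
    have h2 : (1 / 16 : ℝ) ^ p ≤ (t / 8) ^ p :=
      rpow_le_rpow (by norm_num) (by linarith) hp0.le
    have h3 : s * (1 / 16) ^ p * d ^ p ≤ s * (t / 8) ^ p * d ^ p := by gcongr
    have h4 : (‖z‖ ^ p + s * (1 / 16) ^ p * d ^ p) / p ≤ (t * ‖x‖ ^ p + s * ‖y‖ ^ p) / p := by
      refine div_le_div_of_nonneg_right ?_ hp0.le
      linarith
    calc _ = (‖z‖ ^ p + s * (1 / 16) ^ p * d ^ p) / p := by rw [hκ]; ring
      _ ≤ _ := h4
      _ = _ := by ring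
  set A := ‖fderiv ℝ g z‖ + η with hA
  have hA0 : 0 ≤ A := by positivity
  have hq0 : 0 < q := hpq.symm.pos
  suffices h : g x - g z ≤ s * (κ * d ^ p) + s * (16 ^ q / q * A ^ q) by linarith
  rcases le_or_gt d (R + 1) with hcase | hcase
  · have hball : s * d < δ := lt_of_le_of_lt (by gcongr) hsδ
    have hmv : ‖g x - g z‖ ≤ A * ‖x - z‖ := by
      refine (convex_ball z δ).norm_image_sub_le_of_norm_fderiv_le (𝕜 := ℝ)
        (fun w _ => hg w) (fun w hw => ?_) (Metric.mem_ball_self hδ) ?_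
      · have := hδg (Metric.mem_ball.1 hw)
        rw [dist_eq_norm] at this
        have h2 := norm_sub_norm_le (fderiv ℝ g w) (fderiv ℝ g z)
        linarith
      · rw [Metric.mem_ball, dist_eq_norm, hnxz]; exact hball
    have hyoung := young_inequality_of_nonneg (a := d / 16) (b := 16 * A) (by positivity)
      (by positivity) hpq
    rw [mul_rpow (by norm_num) hA0, div_eq_mul_one_div d 16, mul_rpow hd0 (by norm_num)] at hyoung
    calc g x - g z ≤ A * ‖x - z‖ := (le_abs_self _).trans hmv
      _ = s * (d * (1 / 16) * (16 * A)) := by rw [hnxz]; ring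
      _ ≤ s * (d ^ p * (1 / 16) ^ p / p + 16 ^ q * A ^ q / q) := by gcongr
      _ = _ := by rw [hκ]; ring
  · have hmv : ‖g x - g z‖ ≤ L * ‖x - z‖ :=
      convex_univ.norm_image_sub_le_of_norm_fderiv_le (𝕜 := ℝ)
        (fun w _ => hg w) (fun w _ => hL w) trivial trivial
    have hd1 : 0 < d := by linarith
    have hLd : L ≤ κ * d ^ (p - 1) := by
      have h1 : L / κ = R ^ (p - 1) := by
        rw [hR, ← rpow_mul (by positivity), one_div_mul_cancel (by linarith), rpow_one]
      have h2 : R ^ (p - 1) ≤ d ^ (p - 1) := rpow_le_rpow hR0 (by linarith) (by linarith)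
      rw [← h1, div_le_iff₀ hκ0] at h2
      linarith
    have hdp : d ^ (p - 1) * d = d ^ p := by
      rw [rpow_sub_one hd1.ne']; field_simp
    have hpos : 0 ≤ s * (16 ^ q / q * A ^ q) := by positivity
    calc g x - g z ≤ L * ‖x - z‖ := (le_abs_self _).trans hmv
      _ ≤ κ * d ^ (p - 1) * (s * d) := by rw [hnxz]; gcongr
      _ = s * (κ * d ^ p) := by rw [← hdp]; ring
      _ ≤ _ := by linarith

/-- The Prékopa–Leindler inequality relative to a probability measure with density `exp (-Φ) / Z`. -/
theorem lintegral_exp_rpow_le_of_prekopaLeindler {E : Type*} [MeasureSpace E] [AddCommGroup E]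
    [Module ℝ E] {t s : ℝ} (ht : 0 < t) (hs : 0 < s) (hts : t + s = 1)
    (hE : PrekopaLeindler t s E) {Φ : E → ℝ} (hΦ : Measurable Φ) {Z : ℝ} (hZ : 0 < Z)
    {μ : Measure E} [IsProbabilityMeasure μ]
    (hμ : μ = volume.withDensity fun x => ENNReal.ofReal (Real.exp (-Φ x) / Z))
    {u w : E → ℝ} (hu : Measurable u) (hw : Measurable w)
    (H : ∀ x y, u x - (t * Φ x + s * Φ y) ≤ w (t • x + s • y) - Φ (t • x + s • y)) :
    (∫⁻ x, ENNReal.ofReal (exp (u x / t)) ∂μ) ^ t ≤ ∫⁻ x, ENNReal.ofReal (exp (w x)) ∂μ := by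
  have hρ : Measurable fun x => ENNReal.ofReal (Real.exp (-Φ x) / Z) := by fun_prop
  have hmass : ∫⁻ x, ENNReal.ofReal (Real.exp (-Φ x) / Z) = 1 := by
    have := measure_univ (μ := μ)
    rwa [hμ, withDensity_apply _ MeasurableSet.univ, Measure.restrict_univ] at this
  have hu' : Measurable fun x => ENNReal.ofReal (exp (u x / t)) := by fun_prop
  have hw' : Measurable fun x => ENNReal.ofReal (exp (w x)) := by fun_prop
  have key := hE _ _ _ (hρ.mul hu') hρ (hρ.mul hw') (fun x y => by
    simp only [Pi.mul_apply]
    rw [← ENNReal.ofReal_mul (by positivity), ← ENNReal.ofReal_mul (by positivity),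
      ENNReal.ofReal_rpow_of_nonneg (by positivity) ht.le,
      ENNReal.ofReal_rpow_of_nonneg (by positivity) hs.le,
      ← ENNReal.ofReal_mul (by positivity)]
    refine ENNReal.ofReal_le_ofReal ?_
    have hZ' : ∀ a : ℝ, exp a / Z = exp (a - log Z) := fun a => by rw [exp_sub, exp_log hZ]
    simp only [hZ', ← exp_mul, ← exp_add]
    refine exp_le_exp.2 ?_
    have h1 : (-Φ x - log Z + u x / t) * t + (-Φ y - log Z) * s
        = u x - (t * Φ x + s * Φ y) - (t + s) * log Z := by field_simp; ring
    rw [h1, hts]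
    have := H x y
    linarith)
  rw [hmass, ENNReal.one_rpow, mul_one] at key
  rw [hμ, lintegral_withDensity_eq_lintegral_mul _ hρ hu',
    lintegral_withDensity_eq_lintegral_mul _ hρ hw']
  exact key

section Entropy

variable {n : ℕ}

theorem Ent_exp_eq {μ : Measure (EuclideanSpace ℝ (Fin n))} [IsProbabilityMeasure μ]
    {g : EuclideanSpace ℝ (Fin n) → ℝ} (h1 : Integrable (fun x => exp (g x)) μ)
    (h2 : Integrable (fun x => exp (g x) * g x) μ) :
    Ent μ (fun x => exp (g x)) =
      ∫ x, exp (g x) * g x ∂μ - (∫ x, exp (g x) ∂μ) * log (∫ x, exp (g x) ∂μ) := by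
  have hI : 0 < ∫ x, exp (g x) ∂μ := integral_exp_pos h1
  rw [Ent, ← integral_mul_const, ← integral_sub h2 (h1.mul_const _)]
  congr 1
  ext x
  rw [log_div (exp_pos _).ne' hI.ne', log_exp]
  ring

/-- The entropy bounds the growth of the exponential moments of `g` from below. -/
theorem integral_exp_add_Ent_le_rpow {μ : Measure (EuclideanSpace ℝ (Fin n))}
    [IsProbabilityMeasure μ] {g : EuclideanSpace ℝ (Fin n) → ℝ} {t s : ℝ} (ht : 0 < t)
    (hts : t + s = 1) (h1 : Integrable (fun x => exp (g x)) μ)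
    (h2 : Integrable (fun x => exp (g x) * g x) μ)
    (h3 : Integrable (fun x => exp (g x / t)) μ) :
    ∫ x, exp (g x) ∂μ + s * Ent μ (fun x => exp (g x)) ≤ (∫ x, exp (g x / t) ∂μ) ^ t := by
  rw [Ent_exp_eq h1 h2]
  have hI : 0 < ∫ x, exp (g x) ∂μ := integral_exp_pos h1
  set I := ∫ x, exp (g x) ∂μ with hIdef
  set J := ∫ x, exp (g x) * g x ∂μ with hJdef
  set N := ∫ x, exp (g x / t) ∂μ with hNdef
  set L := log I with hL
  set m := s / t * ((J - I * L) / I) with hm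
  have hpt : ∀ x, exp (m + s / t * L) * ((1 - m - s / t * L) * exp (g x)
      + s / t * (exp (g x) * g x)) ≤ exp (g x / t) := fun x => by
    have h4 : exp (g x / t) = exp (m + s / t * L) * exp (g x) * exp (s / t * (g x - L) - m) := by
      rw [← exp_add, ← exp_add]
      congr 1
      rw [show s = 1 - t by linarith]
      field_simp
      ring
    rw [h4]
    have h5 := add_one_le_exp (s / t * (g x - L) - m)
    calc _ = exp (m + s / t * L) * exp (g x) * (s / t * (g x - L) - m + 1) := by ring
      _ ≤ _ := by gcongr
  have hint := integral_mono (((h1.const_mul (1 - m - s / t * L)).add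
    (h2.const_mul (s / t))).const_mul (exp (m + s / t * L))) h3 hpt
  simp only [Pi.add_apply] at hint
  rw [integral_const_mul, integral_add (h1.const_mul _) (h2.const_mul _), integral_const_mul,
    integral_const_mul] at hint
  have hsimp : (1 - m - s / t * L) * I + s / t * J = I := by
    rw [hm]; field_simp; ring
  have hN : exp (m + s / t * L) * I ≤ N := by rw [← hsimp]; exact hint
  have hexpL : I = exp L := by rw [hL, exp_log hI]
  calc I + s * (J - I * L) = I * (s * ((J - I * L) / I) + 1) := by field_simp; ring
    _ ≤ I * exp (s * ((J - I * L) / I)) := by gcongr; exact add_one_le_exp _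
    _ = (exp (m + s / t * L) * I) ^ t := by
      have h6 : I * exp (s * ((J - I * L) / I)) = exp (L + s * ((J - I * L) / I)) := by
        rw [exp_add, ← hexpL]
      have h7 : exp (m + s / t * L) * I = exp (m + s / t * L + L) := by
        rw [exp_add _ L, ← hexpL]
      rw [h6, h7, ← exp_mul]
      congr 1
      rw [hm, show s = 1 - t by linarith]
      field_simp
      ring
    _ ≤ N ^ t := rpow_le_rpow (by positivity) hN ht.le

theorem integrable_exp_of_bounded {μ : Measure (EuclideanSpace ℝ (Fin n))} [IsFiniteMeasure μ]
    {g : EuclideanSpace ℝ (Fin n) → ℝ} (hg : Continuous g) {B : ℝ} (hB : ∀ x, g x ≤ B) :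
    Integrable (fun x => exp (g x)) μ :=
  Integrable.of_bound (by fun_prop) (exp B) (.of_forall fun x => by
    rw [norm_of_nonneg (exp_pos _).le]; exact exp_le_exp.2 (hB x))

theorem integrable_exp_mul_self_of_bounded {μ : Measure (EuclideanSpace ℝ (Fin n))}
    [IsFiniteMeasure μ] {g : EuclideanSpace ℝ (Fin n) → ℝ} (hg : Continuous g) {B : ℝ}
    (hB : ∀ x, |g x| ≤ B) : Integrable (fun x => exp (g x) * g x) μ :=
  Integrable.of_bound (by fun_prop) (exp B * B) (.of_forall fun x => by
    rw [norm_mul, norm_of_nonneg (exp_pos _).le]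
    exact mul_le_mul (exp_le_exp.2 ((le_abs_self _).trans (hB x))) (hB x) (abs_nonneg _)
      (exp_pos _).le)

theorem add_rpow_le_two_rpow_mul {a b q : ℝ} (ha : 0 ≤ a) (hb : 0 ≤ b) (hq : 1 ≤ q) :
    (a + b) ^ q ≤ 2 ^ (q - 1) * (a ^ q + b ^ q) := by
  lift a to NNReal using ha
  lift b to NNReal using hb
  exact_mod_cast NNReal.rpow_add_le_mul_rpow_add_rpow a b hq

/-- The modified logarithmic Sobolev inequality for bounded functions with bounded, uniformly
continuous derivative. -/
theorem Ent_exp_le_of_bounded_fderiv {p q : ℝ} (hp : 2 ≤ p) (hpq : p.HolderConjugate q)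
    {Z : ℝ} (hZ : 0 < Z) {μ : Measure (EuclideanSpace ℝ (Fin n))} [IsProbabilityMeasure μ]
    (hμ : μ = volume.withDensity fun x => ENNReal.ofReal (Real.exp (-(‖x‖ ^ p / p)) / Z))
    {g : EuclideanSpace ℝ (Fin n) → ℝ} (hg : ContDiff ℝ 1 g) {B : ℝ} (hB : ∀ x, |g x| ≤ B)
    {L : ℝ} (hL : ∀ x, ‖fderiv ℝ g x‖ ≤ L) (huc : UniformContinuous (fderiv ℝ g)) :
    Ent μ (fun x => exp (g x)) ≤
      2 ^ q * (16 ^ q / q) * ∫ x, ‖fderiv ℝ g x‖ ^ q * exp (g x) ∂μ := by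
  have hp0 : 0 < p := by linarith
  have hq0 : 0 < q := hpq.symm.pos
  have hq1 : 1 < q := hpq.symm.lt
  have hL0 : 0 ≤ L := (norm_nonneg _).trans (hL 0)
  have hgc : Continuous g := hg.continuous
  have hfc : Continuous (fderiv ℝ g) := hg.continuous_fderiv one_ne_zero
  have hB' : ∀ x, g x ≤ B := fun x => (le_abs_self _).trans (hB x)
  have hI := integrable_exp_of_bounded (μ := μ) hgc hB'
  have hJ := integrable_exp_mul_self_of_bounded (μ := μ) hgc hB
  set I := ∫ x, exp (g x) ∂μ with hIdef
  have hI0 : 0 < I := integral_exp_pos hI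
  set C := (16 : ℝ) ^ q / q with hC
  have hC0 : 0 < C := by positivity
  have hD : Integrable (fun x => ‖fderiv ℝ g x‖ ^ q * exp (g x)) μ := by
    refine Integrable.of_bound (Continuous.aestronglyMeasurable ?_) (L ^ q * exp B) (.of_forall fun x => ?_)
    · exact (hfc.norm.rpow_const fun _ => Or.inr hq0.le).mul (by fun_prop)
    · rw [norm_of_nonneg (by positivity)]
      gcongr
      · exact hL x
      · exact hB' x
  have hη : ∀ η : ℝ, 0 < η → Ent μ (fun x => exp (g x)) ≤
      2 ^ q * C * (∫ x, ‖fderiv ℝ g x‖ ^ q * exp (g x) ∂μ + η ^ q * I) := by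
    intro η hη
    obtain ⟨s₀, hs₀, hkey⟩ := sub_le_sub_add_rpow hp hpq (hg.differentiable one_ne_zero) hL huc hη
    set M := C * (L + η) ^ q with hM
    have hM0 : 0 < M := by positivity
    obtain ⟨s, hs, hsmin⟩ := exists_between (show 0 < min s₀ (min (1 / 2) (1 / M)) by positivity)
    have hss : s < s₀ := hsmin.trans_le (min_le_left _ _)
    have hs2 : s < 1 / 2 := hsmin.trans_le ((min_le_right _ _).trans (min_le_left _ _))
    have hsM : s * M < 1 := by
      rw [← lt_div_iff₀ hM0]
      exact hsmin.trans_le ((min_le_right _ _).trans (min_le_right _ _))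
    set t := 1 - s with htdef
    have ht : 0 < t := by linarith
    have hts : t + s = 1 := by linarith
    set A : EuclideanSpace ℝ (Fin n) → ℝ := fun x => C * (‖fderiv ℝ g x‖ + η) ^ q with hA
    have hAc : Continuous A :=
      continuous_const.mul ((hfc.norm.add continuous_const).rpow_const fun _ => Or.inr hq0.le)
    have hA0 : ∀ x, 0 ≤ A x := fun x => by positivity
    have hAM : ∀ x, A x ≤ M := fun x => by
      simp only [hA, hM]; gcongr; exact hL x
    have hsA : ∀ x, s * A x ≤ 1 := fun x =>
      (mul_le_mul_of_nonneg_left (hAM x) hs.le).trans hsM.le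
    have hPL := lintegral_exp_rpow_le_of_prekopaLeindler ht hs hts
      (PrekopaLeindler.euclideanSpace ht hs hts n) (Φ := fun x => ‖x‖ ^ p / p) (by fun_prop) hZ hμ
      (u := g) (w := fun x => g x + s * A x) hgc.measurable (by fun_prop)
      (hkey t s ht hs hss hts)
    have hN : Integrable (fun x => exp (g x / t)) μ :=
      integrable_exp_of_bounded (by fun_prop) (B := B / t) fun x => by gcongr; exact hB' x
    have hW : Integrable (fun x => exp (g x + s * A x)) μ :=
      integrable_exp_of_bounded (by fun_prop) (B := B + 1) fun x => add_le_add (hB' x) (hsA x)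
    rw [← ofReal_integral_eq_lintegral_ofReal hN (.of_forall fun x => (exp_pos _).le),
      ← ofReal_integral_eq_lintegral_ofReal hW (.of_forall fun x => (exp_pos _).le),
      ENNReal.ofReal_rpow_of_nonneg (integral_nonneg fun x => (exp_pos _).le) ht.le,
      ENNReal.ofReal_le_ofReal_iff (integral_nonneg fun x => (exp_pos _).le)] at hPL
    have hent := (integral_exp_add_Ent_le_rpow ht hts hI hJ hN).trans hPL
    set K := (2 : ℝ) ^ q * C with hK
    have hpt : ∀ x, exp (g x + s * A x) ≤
        exp (g x) + s * (K * (‖fderiv ℝ g x‖ ^ q * exp (g x) + η ^ q * exp (g x))) := fun x => by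
      have h1 := (le_abs_self _).trans (abs_exp_sub_one_le (x := s * A x)
        (by rw [abs_of_nonneg (mul_nonneg hs.le (hA0 x))]; exact hsA x))
      rw [abs_of_nonneg (mul_nonneg hs.le (hA0 x))] at h1
      have h2 : 2 * A x ≤ K * (‖fderiv ℝ g x‖ ^ q + η ^ q) := by
        have h3 := add_rpow_le_two_rpow_mul (norm_nonneg (fderiv ℝ g x)) hη.le hq1.le
        have h4 : (2 : ℝ) ^ q = 2 * 2 ^ (q - 1) := by
          rw [rpow_sub_one two_ne_zero]; ring
        calc 2 * A x ≤ 2 * (C * (2 ^ (q - 1) * (‖fderiv ℝ g x‖ ^ q + η ^ q))) := by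
              simp only [hA]; gcongr
          _ = _ := by rw [hK, h4]; ring
      rw [exp_add]
      calc exp (g x) * exp (s * A x) ≤ exp (g x) * (1 + s * (2 * A x)) := by gcongr; linarith
        _ ≤ exp (g x) * (1 + s * (K * (‖fderiv ℝ g x‖ ^ q + η ^ q))) := by gcongr
        _ = _ := by ring
    have hDη : Integrable (fun x => ‖fderiv ℝ g x‖ ^ q * exp (g x) + η ^ q * exp (g x)) μ :=
      hD.add (hI.const_mul _)
    have hint := integral_mono hW (hI.add ((hDη.const_mul K).const_mul s)) hpt
    rw [integral_add' hI ((hDη.const_mul K).const_mul s), integral_const_mul, integral_const_mul,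
      integral_add hD (hI.const_mul _), integral_const_mul] at hint
    have hfin := hent.trans hint
    exact le_of_mul_le_mul_left (by linarith) hs
  have hlim : Filter.Tendsto (fun η : ℝ => 2 ^ q * C *
      (∫ x, ‖fderiv ℝ g x‖ ^ q * exp (g x) ∂μ + η ^ q * I)) (nhdsWithin 0 (Set.Ioi 0))
      (nhds (2 ^ q * C * (∫ x, ‖fderiv ℝ g x‖ ^ q * exp (g x) ∂μ + 0 ^ q * I))) := by
    have : Continuous fun η : ℝ => 2 ^ q * C *
        (∫ x, ‖fderiv ℝ g x‖ ^ q * exp (g x) ∂μ + η ^ q * I) := by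
      have := continuous_rpow_const hq0.le
      fun_prop
    exact (this.tendsto 0).mono_left nhdsWithin_le_nhds
  rw [zero_rpow hq0.ne', zero_mul, add_zero] at hlim
  exact ge_of_tendsto hlim (Filter.eventually_of_mem self_mem_nhdsWithin hη)

theorem tendsto_Ent_exp {μ : Measure (EuclideanSpace ℝ (Fin n))} [IsProbabilityMeasure μ]
    {G : ℕ → EuclideanSpace ℝ (Fin n) → ℝ} {g : EuclideanSpace ℝ (Fin n) → ℝ}
    (hG : ∀ k, Continuous (G k)) (hg : Continuous g)
    (hlim : ∀ x, Filter.Tendsto (fun k => G k x) Filter.atTop (nhds (g x)))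
    {F₁ F₂ : EuclideanSpace ℝ (Fin n) → ℝ} (hF₁ : Integrable F₁ μ) (hF₂ : Integrable F₂ μ)
    (h₁ : ∀ k x, exp (G k x) ≤ F₁ x) (h₂ : ∀ k x, |exp (G k x) * G k x| ≤ F₂ x) :
    Filter.Tendsto (fun k => Ent μ (fun x => exp (G k x))) Filter.atTop
      (nhds (Ent μ (fun x => exp (g x)))) := by
  have hl₁ : ∀ x, Filter.Tendsto (fun k => exp (G k x)) Filter.atTop (nhds (exp (g x))) :=
    fun x => (continuous_exp.tendsto _).comp (hlim x)
  have hl₂ : ∀ x, Filter.Tendsto (fun k => exp (G k x) * G k x) Filter.atTop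
      (nhds (exp (g x) * g x)) := fun x => (hl₁ x).mul (hlim x)
  have hb₁ : ∀ k x, ‖exp (G k x)‖ ≤ F₁ x := fun k x => by
    rw [norm_of_nonneg (exp_pos _).le]; exact h₁ k x
  have hi₁ : ∀ k, Integrable (fun x => exp (G k x)) μ := fun k =>
    hF₁.mono' (by have := hG k; fun_prop) (.of_forall (hb₁ k))
  have hi₂ : ∀ k, Integrable (fun x => exp (G k x) * G k x) μ := fun k =>
    hF₂.mono' (by have := hG k; fun_prop) (.of_forall (h₂ k))
  have hj₁ : Integrable (fun x => exp (g x)) μ := hF₁.mono' (by fun_prop) (.of_forall fun x =>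
    le_of_tendsto' (hl₁ x).norm fun k => hb₁ k x)
  have hj₂ : Integrable (fun x => exp (g x) * g x) μ := hF₂.mono' (by fun_prop)
    (.of_forall fun x => le_of_tendsto' (hl₂ x).norm fun k => h₂ k x)
  rw [Ent_exp_eq hj₁ hj₂]
  simp only [fun k => Ent_exp_eq (hi₁ k) (hi₂ k)]
  have ht₁ := tendsto_integral_of_dominated_convergence F₁
    (fun k => (hi₁ k).aestronglyMeasurable) hF₁ (fun k => .of_forall (hb₁ k)) (.of_forall hl₁)
  have ht₂ := tendsto_integral_of_dominated_convergence F₂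
    (fun k => (hi₂ k).aestronglyMeasurable) hF₂ (fun k => .of_forall (h₂ k)) (.of_forall hl₂)
  exact ht₂.sub (ht₁.mul (ht₁.log (integral_exp_pos hj₁).ne'))

/-- A modified logarithmic Sobolev inequality for compactly supported functions extends to bounded
functions. -/
theorem Ent_exp_le_of_bounded {μ : Measure (EuclideanSpace ℝ (Fin n))} [IsProbabilityMeasure μ]
    {q c : ℝ} (hq : 1 ≤ q)
    (H : ∀ g : EuclideanSpace ℝ (Fin n) → ℝ, ContDiff ℝ 1 g → HasCompactSupport g →
      Ent μ (fun x => exp (g x)) ≤ c * ∫ x, ‖fderiv ℝ g x‖ ^ q * exp (g x) ∂μ)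
    {g : EuclideanSpace ℝ (Fin n) → ℝ} (hg : ContDiff ℝ 1 g) {B : ℝ} (hB : ∀ x, |g x| ≤ B)
    (hD : Integrable (fun x => ‖fderiv ℝ g x‖ ^ q * exp (g x)) μ) :
    Ent μ (fun x => exp (g x)) ≤ c * ∫ x, ‖fderiv ℝ g x‖ ^ q * exp (g x) ∂μ := by
  have hq0 : 0 < q := by linarith
  have hB0 : 0 ≤ B := (abs_nonneg _).trans (hB 0)
  have hgc : Continuous g := hg.continuous
  have hfc : Continuous (fderiv ℝ g) := hg.continuous_fderiv one_ne_zero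
  let χ : ContDiffBump (0 : EuclideanSpace ℝ (Fin n)) := default
  have hχ : ContDiff ℝ 1 χ := χ.contDiff
  have hχfc : Continuous (fderiv ℝ χ) := hχ.continuous_fderiv one_ne_zero
  obtain ⟨K, hK⟩ := (χ.hasCompactSupport.fderiv ℝ).exists_bound_of_continuous hχfc
  have hK0 : 0 ≤ K := (norm_nonneg _).trans (hK 0)
  set r : ℕ → ℝ := fun k => 1 / ((k : ℝ) + 1) with hr
  have hr0 : ∀ k, 0 < r k := fun k => by positivity
  have hr1 : ∀ k, r k ≤ 1 := fun k => by
    rw [hr, div_le_one (by positivity)]; linarith [(Nat.cast_nonneg k : (0 : ℝ) ≤ k)]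
  have hrlim : Filter.Tendsto r Filter.atTop (nhds 0) := tendsto_one_div_add_atTop_nhds_zero_nat
  have hχr : ∀ k, ContDiff ℝ 1 fun x => χ (r k • x) := fun k =>
    hχ.comp (contDiff_const_smul (r k))
  have hrx : ∀ x : EuclideanSpace ℝ (Fin n),
      Filter.Tendsto (fun k => r k • x) Filter.atTop (nhds 0) := fun x => by
    simpa using hrlim.smul_const x
  have hχlim : ∀ x, Filter.Tendsto (fun k => χ (r k • x)) Filter.atTop (nhds 1) := fun x => by
    have h1 : χ 0 = 1 := χ.one_of_mem_closedBall (Metric.mem_closedBall_self χ.rIn_pos.le)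
    simpa [h1, Function.comp_def] using (χ.continuous.tendsto 0).comp (hrx x)
  set G : ℕ → EuclideanSpace ℝ (Fin n) → ℝ := fun k x => χ (r k • x) * g x with hGdef
  have hG : ∀ k, ContDiff ℝ 1 (G k) := fun k => (hχr k).mul hg
  have hGs : ∀ k, HasCompactSupport (G k) := fun k =>
    HasCompactSupport.mul_right (χ.hasCompactSupport.comp_smul (hr0 k).ne')
  have hGlim : ∀ x, Filter.Tendsto (fun k => G k x) Filter.atTop (nhds (g x)) := fun x => by
    simpa using (hχlim x).mul_const (g x)
  have hGB : ∀ k x, |G k x| ≤ B := fun k x => by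
    rw [hGdef, abs_mul, abs_of_nonneg χ.nonneg]
    exact (mul_le_of_le_one_left (abs_nonneg _) χ.le_one).trans (hB x)
  have hGexp : ∀ k x, exp (G k x) ≤ exp B := fun k x =>
    exp_le_exp.2 ((le_abs_self _).trans (hGB k x))
  have hGd : ∀ k x, fderiv ℝ (G k) x
      = χ (r k • x) • fderiv ℝ g x + g x • (r k • fderiv ℝ χ (r k • x)) := fun k x => by
    rw [hGdef, fderiv_fun_mul ((hχr k).differentiable one_ne_zero x)
      (hg.differentiable one_ne_zero x), fderiv_comp_smul]
  have hGdlim : ∀ x, Filter.Tendsto (fun k => fderiv ℝ (G k) x) Filter.atTop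
      (nhds (fderiv ℝ g x)) := fun x => by
    simp only [hGd]
    have h1 := (hχfc.tendsto 0).comp (hrx x)
    have h2 := ((hχlim x).smul_const (fderiv ℝ g x)).add ((hrlim.smul h1).const_smul (g x))
    simpa using h2
  have hGdB : ∀ k x, ‖fderiv ℝ (G k) x‖ ≤ ‖fderiv ℝ g x‖ + B * K := fun k x => by
    rw [hGd]
    refine (norm_add_le _ _).trans (add_le_add ?_ ?_)
    · rw [norm_smul, norm_of_nonneg χ.nonneg]
      exact mul_le_of_le_one_left (norm_nonneg _) χ.le_one
    · rw [norm_smul, norm_smul, norm_of_nonneg (hr0 k).le]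
      exact mul_le_mul (hB x) ((mul_le_of_le_one_left (norm_nonneg _) (hr1 k)).trans (hK _))
        (by have := hr0 k; positivity) hB0
  have hbound : ∀ k x, ‖‖fderiv ℝ (G k) x‖ ^ q * exp (G k x)‖ ≤
      2 ^ (q - 1) * (exp B * (‖fderiv ℝ g x‖ ^ q * exp (g x)) + (B * K) ^ q) * exp B :=
    fun k x => by
      rw [norm_of_nonneg (by positivity)]
      have h1 : 1 ≤ exp B * exp (g x) := by
        rw [← exp_add]; exact one_le_exp (by linarith [neg_abs_le (g x), hB x])
      have h2 : ‖fderiv ℝ g x‖ ^ q ≤ exp B * (‖fderiv ℝ g x‖ ^ q * exp (g x)) := by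
        calc _ ≤ ‖fderiv ℝ g x‖ ^ q * (exp B * exp (g x)) :=
              le_mul_of_one_le_right (by positivity) h1
          _ = _ := by ring
      refine mul_le_mul ?_ (hGexp k x) (exp_pos _).le (by positivity)
      calc ‖fderiv ℝ (G k) x‖ ^ q ≤ (‖fderiv ℝ g x‖ + B * K) ^ q := by gcongr; exact hGdB k x
        _ ≤ _ := add_rpow_le_two_rpow_mul (norm_nonneg _) (by positivity) hq
        _ ≤ _ := by gcongr
  have hbi : Integrable (fun x => 2 ^ (q - 1) * (exp B * (‖fderiv ℝ g x‖ ^ q * exp (g x))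
      + (B * K) ^ q) * exp B) μ :=
    (((hD.const_mul _).add (integrable_const _)).const_mul _).mul_const _
  have hRlim := tendsto_integral_of_dominated_convergence
    (F := fun k x => ‖fderiv ℝ (G k) x‖ ^ q * exp (G k x)) _
    (fun k => Continuous.aestronglyMeasurable
      ((((hG k).continuous_fderiv one_ne_zero).norm.rpow_const fun _ => Or.inr hq0.le).mul
        (continuous_exp.comp (hG k).continuous)))
    hbi (fun k => .of_forall (hbound k))
    (.of_forall fun x => ((hGdlim x).norm.rpow_const (Or.inr hq0.le)).mul
      ((continuous_exp.tendsto _).comp (hGlim x)))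
  have hLlim := tendsto_Ent_exp (μ := μ) (fun k => (hG k).continuous) hgc hGlim
    (integrable_const (exp B)) (integrable_const (exp B * B)) hGexp fun k x => by
      rw [abs_mul, abs_of_nonneg (exp_pos _).le]
      exact mul_le_mul (hGexp k x) (hGB k x) (abs_nonneg _) (exp_pos _).le
  exact le_of_tendsto_of_tendsto' hLlim (hRlim.const_mul c) fun k => H _ (hG k) (hGs k)

/-- A smooth bounded truncation of the identity: the logarithm of `(v + ε) / (1 + ε v)`
at `v = exp u`. -/
noncomputable def logTruncation (ε u : ℝ) : ℝ := log (exp u + ε) - log (1 + ε * exp u)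

theorem exp_logTruncation {ε : ℝ} (hε : 0 < ε) (u : ℝ) :
    exp (logTruncation ε u) = (exp u + ε) / (1 + ε * exp u) := by
  rw [logTruncation, exp_sub, exp_log (by positivity), exp_log (by positivity)]

theorem contDiff_logTruncation {ε : ℝ} (hε : 0 < ε) : ContDiff ℝ 1 (logTruncation ε) :=
  ((contDiff_exp.add contDiff_const).log fun x => by positivity).sub
    ((contDiff_const.add (contDiff_const.mul contDiff_exp)).log fun x => by positivity)

theorem hasDerivAt_logTruncation {ε : ℝ} (hε : 0 < ε) (u : ℝ) :
    HasDerivAt (logTruncation ε) (exp u / (exp u + ε) - ε * exp u / (1 + ε * exp u)) u :=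
  (((hasDerivAt_exp u).add_const ε).log (by positivity)).sub
    ((((hasDerivAt_exp u).const_mul ε).const_add 1).log (by positivity))

theorem abs_logTruncation_le {ε : ℝ} (hε : 0 < ε) (hε1 : ε ≤ 1) (u : ℝ) :
    |logTruncation ε u| ≤ -log ε := by
  have hv := exp_pos u
  rw [abs_le, neg_neg]
  constructor
  · rw [← exp_le_exp, exp_log hε, exp_logTruncation hε, le_div_iff₀ (by positivity)]
    nlinarith [mul_le_one₀ hε1 hε.le hε1]
  · rw [← exp_le_exp, exp_neg, exp_log hε, exp_logTruncation hε, div_le_iff₀ (by positivity),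
      inv_mul_eq_div, le_div_iff₀ hε]
    nlinarith [mul_le_one₀ hε1 hε.le hε1]

theorem exp_logTruncation_le {ε : ℝ} (hε : 0 < ε) (hε1 : ε ≤ 1) (u : ℝ) :
    exp (logTruncation ε u) ≤ exp u + 1 := by
  rw [exp_logTruncation hε]
  refine (div_le_self (by positivity) ?_).trans (by linarith)
  have : 0 ≤ ε * exp u := by positivity
  linarith

theorem abs_exp_logTruncation_mul_self_le {ε : ℝ} (hε : 0 < ε) (hε1 : ε ≤ 1) (u : ℝ) :
    |exp (logTruncation ε u) * logTruncation ε u| ≤ |exp u * u| + exp u + 1 := by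
  set T := logTruncation ε u
  have hv := exp_pos u
  have hT := exp_logTruncation_le hε hε1 u
  have hlog1 : log (exp u + 1) ≤ u + exp (-u) := by
    have h1 : exp u + 1 = exp u * (1 + exp (-u)) := by
      rw [mul_add, ← exp_add]; simp
    rw [h1, log_mul hv.ne' (by positivity), log_exp]
    linarith [log_le_sub_one_of_pos (show 0 < 1 + exp (-u) by positivity)]
  have hlog2 : log (exp u + 1) ≤ exp u := by
    linarith [log_le_sub_one_of_pos (show 0 < exp u + 1 by positivity)]
  have hlog0 : 0 ≤ log (exp u + 1) := log_nonneg (by linarith)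
  have hTlog : T ≤ log (exp u + 1) := by rw [le_log_iff_exp_le (by positivity)]; exact hT
  rw [abs_le]
  constructor
  · have h1 : 1 - exp (-T) ≤ T := by linarith [add_one_le_exp (-T)]
    have h2 : exp T * (1 - exp (-T)) ≤ exp T * T := by gcongr
    rw [mul_sub, ← exp_add, add_neg_cancel, exp_zero] at h2
    linarith [exp_pos T, abs_nonneg (exp u * u)]
  · calc exp T * T ≤ exp T * log (exp u + 1) := by gcongr
      _ ≤ (exp u + 1) * log (exp u + 1) := by gcongr
      _ ≤ exp u * (u + exp (-u)) + exp u := by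
        rw [add_mul, one_mul]; gcongr
      _ = exp u * u + 1 + exp u := by rw [mul_add, ← exp_add]; simp
      _ ≤ _ := by linarith [le_abs_self (exp u * u)]

theorem abs_deriv_logTruncation_rpow_mul_exp_le {ε q : ℝ} (hε : 0 < ε) (hε1 : ε ≤ 1)
    (hq : 1 ≤ q) (u : ℝ) :
    |exp u / (exp u + ε) - ε * exp u / (1 + ε * exp u)| ^ q * exp (logTruncation ε u)
      ≤ exp u := by
  rw [exp_logTruncation hε]
  have hv := exp_pos u
  set v := exp u
  have h0 : 0 ≤ v / (v + ε) - ε * v / (1 + ε * v) := by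
    rw [sub_nonneg, div_le_div_iff₀ (by positivity) (by positivity)]
    nlinarith [mul_le_one₀ hε1 hε.le hε1]
  have h1 : |v / (v + ε) - ε * v / (1 + ε * v)| ≤ v / (v + ε) := by
    rw [abs_of_nonneg h0]
    have : 0 ≤ ε * v / (1 + ε * v) := by positivity
    linarith
  have h2 : v / (v + ε) ≤ 1 := by rw [div_le_one (by positivity)]; linarith
  calc _ ≤ (v / (v + ε)) ^ q * ((v + ε) / (1 + ε * v)) := by gcongr
    _ ≤ v / (v + ε) * ((v + ε) / (1 + ε * v)) := by
      gcongr
      exact rpow_le_self_of_le_one (by positivity) h2 hq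
    _ = v / (1 + ε * v) := by field_simp
    _ ≤ v := div_le_self hv.le (by linarith [mul_pos hε hv])

theorem tendsto_logTruncation (u : ℝ) :
    Filter.Tendsto (fun ε => logTruncation ε u) (nhds 0) (nhds u) := by
  have h : ContinuousAt (fun ε => logTruncation ε u) 0 := by
    unfold logTruncation
    refine ContinuousAt.sub (ContinuousAt.log (by fun_prop) ?_) (ContinuousAt.log (by fun_prop) ?_)
    · simp
    · simp
  simpa [logTruncation] using h.tendsto

/-- A modified logarithmic Sobolev inequality for compactly supported functions extends to all
`C¹` functions for which its terms are integrable. -/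
theorem Ent_exp_le_of_integrable {μ : Measure (EuclideanSpace ℝ (Fin n))}
    [IsProbabilityMeasure μ] {q c : ℝ} (hq : 1 ≤ q) (hc : 0 ≤ c)
    (H : ∀ g : EuclideanSpace ℝ (Fin n) → ℝ, ContDiff ℝ 1 g → HasCompactSupport g →
      Ent μ (fun x => exp (g x)) ≤ c * ∫ x, ‖fderiv ℝ g x‖ ^ q * exp (g x) ∂μ)
    {g : EuclideanSpace ℝ (Fin n) → ℝ} (hg : ContDiff ℝ 1 g)
    (hI : Integrable (fun x => exp (g x)) μ) (hJ : Integrable (fun x => exp (g x) * g x) μ)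
    (hD : Integrable (fun x => ‖fderiv ℝ g x‖ ^ q * exp (g x)) μ) :
    Ent μ (fun x => exp (g x)) ≤ c * ∫ x, ‖fderiv ℝ g x‖ ^ q * exp (g x) ∂μ := by
  set r : ℕ → ℝ := fun k => 1 / ((k : ℝ) + 1) with hr
  have hr0 : ∀ k, 0 < r k := fun k => by positivity
  have hr1 : ∀ k, r k ≤ 1 := fun k => by
    rw [hr, div_le_one (by positivity)]; linarith [(Nat.cast_nonneg k : (0 : ℝ) ≤ k)]
  have hrlim : Filter.Tendsto r Filter.atTop (nhds 0) := tendsto_one_div_add_atTop_nhds_zero_nat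
  set G : ℕ → EuclideanSpace ℝ (Fin n) → ℝ := fun k x => logTruncation (r k) (g x) with hGdef
  have hG : ∀ k, ContDiff ℝ 1 (G k) := fun k => (contDiff_logTruncation (hr0 k)).comp hg
  have hGd : ∀ k x, ‖fderiv ℝ (G k) x‖ ^ q * exp (G k x) ≤ ‖fderiv ℝ g x‖ ^ q * exp (g x) :=
    fun k x => by
      have h1 := (hasDerivAt_logTruncation (hr0 k) (g x)).comp_hasFDerivAt x
        (hg.differentiable one_ne_zero x).hasFDerivAt
      have h2 : fderiv ℝ (G k) x = _ := h1.fderiv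
      rw [h2, norm_smul, mul_rpow (norm_nonneg _) (norm_nonneg _), Real.norm_eq_abs,
        mul_comm (_ ^ q) (‖fderiv ℝ g x‖ ^ q), mul_assoc]
      gcongr
      exact abs_deriv_logTruncation_rpow_mul_exp_le (hr0 k) (hr1 k) hq (g x)
  have hGD : ∀ k, Integrable (fun x => ‖fderiv ℝ (G k) x‖ ^ q * exp (G k x)) μ := fun k =>
    hD.mono' (Continuous.aestronglyMeasurable
      ((((hG k).continuous_fderiv one_ne_zero).norm.rpow_const fun _ =>
        Or.inr (by linarith)).mul (continuous_exp.comp (hG k).continuous)))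
      (.of_forall fun x => by rw [norm_of_nonneg (by positivity)]; exact hGd k x)
  refine le_of_tendsto' (tendsto_Ent_exp (μ := μ) (fun k => (hG k).continuous) hg.continuous
    (fun x => (tendsto_logTruncation (g x)).comp hrlim)
    (hI.add (integrable_const 1)) ((hJ.abs.add hI).add (integrable_const 1))
    (fun k x => exp_logTruncation_le (hr0 k) (hr1 k) (g x))
    (fun k x => abs_exp_logTruncation_mul_self_le (hr0 k) (hr1 k) (g x))) fun k => ?_
  refine (Ent_exp_le_of_bounded hq H (hG k)
    (fun x => abs_logTruncation_le (hr0 k) (hr1 k) (g x)) (hGD k)).trans ?_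
  exact mul_le_mul_of_nonneg_left (integral_mono (hGD k) hD (hGd k)) hc

theorem norm_gradient_eq_norm_fderiv (g : EuclideanSpace ℝ (Fin n) → ℝ)
    (x : EuclideanSpace ℝ (Fin n)) : ‖gradient g x‖ = ‖fderiv ℝ g x‖ := by
  rw [← toDual_gradient, LinearIsometryEquiv.norm_map]

end Entropy

theorem bobkov_ledoux_log_sobolev (n : ℕ) (p q : ℝ) (hp : 2 ≤ p) (hpq : 1 / p + 1 / q = 1)
    (Z : ℝ) (hZ : Z = ∫ x : EuclideanSpace ℝ (Fin n), Real.exp (-(‖x‖ ^ p / p)))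
    (μ : Measure (EuclideanSpace ℝ (Fin n)))
    (hμ : μ = volume.withDensity fun x => ENNReal.ofReal (Real.exp (-(‖x‖ ^ p / p)) / Z)) :
    ∃ c > 0, ∀ g : EuclideanSpace ℝ (Fin n) → ℝ, ContDiff ℝ 1 g →
      Integrable (fun x => Real.exp (g x)) μ →
      Integrable (fun x =>
        Real.exp (g x) * Real.log (Real.exp (g x) / ∫ y, Real.exp (g y) ∂μ)) μ →
      Integrable (fun x => ‖gradient g x‖ ^ q * Real.exp (g x)) μ →
      Ent μ (fun x => Real.exp (g x)) ≤ c * ∫ x, ‖gradient g x‖ ^ q * Real.exp (g x) ∂μ := by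
  have hconj : p.HolderConjugate q := by
    rw [Real.holderConjugate_iff]
    exact ⟨by linarith, by simpa using hpq⟩
  have hq0 : 0 < q := hconj.symm.pos
  refine ⟨2 ^ q * (16 ^ q / q), by positivity, fun g hg hI hJ hD => ?_⟩
  have hZ0 : 0 ≤ Z := hZ ▸ integral_nonneg fun x => (exp_pos _).le
  rcases hZ0.eq_or_lt with hZ0 | hZ0
  · have hμ0 : μ = 0 := by rw [hμ, ← hZ0]; simp
    simp [hμ0, Ent]
  have hint : Integrable fun x : EuclideanSpace ℝ (Fin n) => exp (-(‖x‖ ^ p / p)) := by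
    by_contra h
    rw [integral_undef h] at hZ
    exact hZ0.ne' hZ
  have hprob : IsProbabilityMeasure μ := ⟨by
    rw [hμ, withDensity_apply _ MeasurableSet.univ, Measure.restrict_univ,
      ← ofReal_integral_eq_lintegral_ofReal (hint.div_const Z)
        (.of_forall fun x => by positivity), integral_div, ← hZ, div_self hZ0.ne',
      ENNReal.ofReal_one]⟩
  simp only [norm_gradient_eq_norm_fderiv] at hD ⊢
  have hI0 : 0 < ∫ x, exp (g x) ∂μ := integral_exp_pos hI
  have hJ' : Integrable (fun x => exp (g x) * g x) μ := by
    refine (hJ.add (hI.mul_const (log (∫ x, exp (g x) ∂μ)))).congr (.of_forall fun x => ?_)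
    simp only [Pi.add_apply]
    rw [log_div (exp_pos _).ne' hI0.ne', log_exp]
    ring
  refine Ent_exp_le_of_integrable hconj.symm.lt.le (by positivity) (fun u hu hus => ?_) hg hI hJ' hD
  have huf : Continuous (fderiv ℝ u) := hu.continuous_fderiv one_ne_zero
  obtain ⟨B, hB⟩ := hus.exists_bound_of_continuous hu.continuous
  obtain ⟨L, hL⟩ := (hus.fderiv ℝ).exists_bound_of_continuous huf
  exact Ent_exp_le_of_bounded_fderiv hp hconj hZ0 hμ hu hB hL
    ((hus.fderiv ℝ).uniformContinuous_of_continuous huf)
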